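/- Let (φ_i, ξ_i, η_i), i = 1,2,3, be an abelian almost 3-contact structure on a finite-dimensional real Lie algebra 𝔤. For a = (a_1, a_2, a_3) ∈ ℝ³ with a_1² + a_2² + a_3² = 1, define φ_a := a_1φ_1 + a_2φ_2 + a_3φ_3, ξ_a := a_1ξ_1 + a_2ξ_2 + a_3ξ_3, η_a := a_1η_1 + a_2η_2 + a_3η_3. Then (φ_a, ξ_a, η_a) is an almost contact structure on 𝔤 (φ_a(φ_a(x)) = −x + η_a(x)·ξ_a and η_a(ξ_a) = 1) and it is abelian: [ξ_a, φ_a(x)] = φ_a([ξ_a, x]) for all x ∈ 𝔤 and [φ_a(X), φ_a(Y)] = [X, Y] for all X, Y ∈ ker η_a. -/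

import Mathlib

/-- `(i,j,k)` is an even permutation of `(1,2,3)` (indexed here as `(0,1,2)`). -/
def evenPerm (i j k : Fin 3) : Prop :=
  (i, j, k) = ((0 : Fin 3), (1 : Fin 3), (2 : Fin 3)) ∨
  (i, j, k) = ((1 : Fin 3), (2 : Fin 3), (0 : Fin 3)) ∨
  (i, j, k) = ((2 : Fin 3), (0 : Fin 3), (1 : Fin 3))

/-- An abelian almost 3-contact structure on a real Lie algebra `L`: three almost
contact structures `(φ i, ξ i, η i)` satisfying the quaternionic-like compatibility
relations for every even permutation `(i,j,k)` of `(1,2,3)`, each of which is abelian. -/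
structure AbelianAC3 (L : Type*) [LieRing L] [LieAlgebra ℝ L] where
  φ : Fin 3 → (L →ₗ[ℝ] L)
  ξ : Fin 3 → L
  η : Fin 3 → (L →ₗ[ℝ] ℝ)
  acs : ∀ i, ∀ x : L, φ i (φ i x) = -x + η i x • ξ i
  unit : ∀ i, η i (ξ i) = 1
  comp_phi : ∀ i j k, evenPerm i j k → ∀ x : L, φ k x = φ i (φ j x) - η j x • ξ i
  comp_phi' : ∀ i j k, evenPerm i j k → ∀ x : L, φ k x = -φ j (φ i x) + η i x • ξ j
  comp_xi : ∀ i j k, evenPerm i j k → φ i (ξ j) = ξ k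
  comp_xi' : ∀ i j k, evenPerm i j k → φ j (ξ i) = -ξ k
  comp_eta : ∀ i j k, evenPerm i j k → ∀ x : L, η i (φ j x) = η k x
  comp_eta' : ∀ i j k, evenPerm i j k → ∀ x : L, η j (φ i x) = -η k x
  abelian_ad : ∀ i, ∀ x : L, ⁅ξ i, φ i x⁆ = φ i ⁅ξ i, x⁆
  abelian_br : ∀ i, ∀ X Y : L, η i X = 0 → η i Y = 0 → ⁅φ i X, φ i Y⁆ = ⁅X, Y⁆

namespace AbelianAC3

variable {L : Type*} [LieRing L] [LieAlgebra ℝ L]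

/-- Membership in the horizontal subspace `𝔥 = ⋂ ker (η i)`. -/
def inH (S : AbelianAC3 L) (x : L) : Prop := ∀ i, S.η i x = 0

/-- The horizontal subspace `𝔥` as a submodule. -/
def H (S : AbelianAC3 L) : Submodule ℝ L :=
  LinearMap.ker (S.η 0) ⊓ LinearMap.ker (S.η 1) ⊓ LinearMap.ker (S.η 2)

/-- The vertical subspace `𝔳 = span{ξ₁, ξ₂, ξ₃}`. -/
def V (S : AbelianAC3 L) : Submodule ℝ L :=
  Submodule.span ℝ {S.ξ 0, S.ξ 1, S.ξ 2}

/-- The endomorphism `ψ(X) = [ξ₁, φ₁ X]` (as a linear map on all of `L`). -/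
def psi (S : AbelianAC3 L) : L →ₗ[ℝ] L :=
  (LieAlgebra.ad ℝ L (S.ξ 0)) ∘ₗ (S.φ 0)

/-- The distinguished horizontal vector `𝒵 = φ₁([ξ₂, ξ₃])`. -/
def Z (S : AbelianAC3 L) : L := S.φ 0 ⁅S.ξ 1, S.ξ 2⁆

end AbelianAC3

theorem evenPerm.rotate {i j k : Fin 3} (h : evenPerm i j k) : evenPerm j k i := by
  rcases h with h | h | h <;> simp only [Prod.mk.injEq] at h <;>
    obtain ⟨rfl, rfl, rfl⟩ := h <;> simp [evenPerm]

theorem evenPerm.eq_or_eq_or_eq {i j k : Fin 3} (h : evenPerm i j k) (l : Fin 3) :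
    l = i ∨ l = j ∨ l = k := by
  rcases h with h | h | h <;> simp only [Prod.mk.injEq] at h <;>
    obtain ⟨rfl, rfl, rfl⟩ := h <;> fin_cases l <;> simp

theorem evenPerm_zero_one_two : evenPerm 0 1 2 := Or.inl rfl

namespace AbelianAC3

section Basic

variable {L : Type*} [LieRing L] [LieAlgebra ℝ L] (S : AbelianAC3 L) {i j k : Fin 3}

theorem phi_xi_self (i : Fin 3) : S.φ i (S.ξ i) = 0 := by
  have h1 : S.φ i (S.φ i (S.ξ i)) = 0 := by simp [S.acs, S.unit]
  have h2 : S.φ i (S.ξ i) = S.η i (S.φ i (S.ξ i)) • S.ξ i := by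
    have := S.acs i (S.φ i (S.ξ i))
    rw [h1, map_zero] at this
    exact neg_add_eq_zero.mp this.symm
  set c := S.η i (S.φ i (S.ξ i)) with hc
  rw [h2, map_smul, h2, smul_smul] at h1
  have h3 := congrArg (S.η i) h1
  simp only [map_smul, S.unit, map_zero, smul_eq_mul, mul_one, mul_self_eq_zero] at h3
  rw [h2, h3, zero_smul]

theorem eta_phi_self (i : Fin 3) (x : L) : S.η i (S.φ i x) = 0 := by
  have h := congrArg (S.φ i) (S.acs i x)
  rw [S.acs i (S.φ i x), map_add, map_neg, map_smul, S.phi_xi_self, smul_zero, add_zero,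
    add_eq_left] at h
  simpa [S.unit] using congrArg (S.η i) h

theorem phi_xi_prev (h : evenPerm i j k) : S.φ i (S.ξ k) = -S.ξ j :=
  S.comp_xi' k i j h.rotate.rotate

theorem eta_xi_next (h : evenPerm i j k) : S.η i (S.ξ j) = 0 := by
  have := S.eta_phi_self i (S.ξ k)
  rwa [S.phi_xi_prev h, map_neg, neg_eq_zero] at this

theorem eta_xi_prev (h : evenPerm i j k) : S.η i (S.ξ k) = 0 := by
  rw [← S.comp_xi i j k h, S.eta_phi_self]

theorem inH_phi {y : L} (hy : S.inH y) (l : Fin 3) : S.inH (S.φ l y) := by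
  have aux : ∀ {i j k : Fin 3}, evenPerm i j k → S.inH (S.φ i y) := by
    intro i j k h l
    rcases h.eq_or_eq_or_eq l with rfl | rfl | rfl
    · exact S.eta_phi_self _ y
    · rw [S.comp_eta' _ _ _ h, hy, neg_zero]
    · rw [S.comp_eta _ _ _ h.rotate.rotate, hy]
  rcases evenPerm_zero_one_two.eq_or_eq_or_eq l with rfl | rfl | rfl
  · exact aux evenPerm_zero_one_two
  · exact aux evenPerm_zero_one_two.rotate
  · exact aux evenPerm_zero_one_two.rotate.rotate

theorem exists_inH_add (h : evenPerm i j k) (x : L) :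
    ∃ y, S.inH y ∧ x = y + S.η i x • S.ξ i + S.η j x • S.ξ j + S.η k x • S.ξ k := by
  refine ⟨x - S.η i x • S.ξ i - S.η j x • S.ξ j - S.η k x • S.ξ k, fun l ↦ ?_, by abel⟩
  rcases h.eq_or_eq_or_eq l with rfl | rfl | rfl <;>
    simp [S.unit, S.eta_xi_next h, S.eta_xi_prev h, S.eta_xi_next h.rotate,
      S.eta_xi_prev h.rotate, S.eta_xi_next h.rotate.rotate, S.eta_xi_prev h.rotate.rotate]

theorem phi_phi_next_of_inH (h : evenPerm i j k) {y : L} (hy : S.inH y) :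
    S.φ i (S.φ j y) = S.φ k y := by
  simp [S.comp_phi i j k h, hy j]

theorem phi_phi_prev_of_inH (h : evenPerm i j k) {y : L} (hy : S.inH y) :
    S.φ j (S.φ i y) = -S.φ k y := by
  simp [S.comp_phi' i j k h, hy i]

/-! ### Brackets with a horizontal vector -/

theorem lie_xi_phi_next (h : evenPerm i j k) {y : L} (hy : S.inH y) :
    ⁅S.ξ k, S.φ i y⁆ = ⁅S.ξ j, y⁆ := by
  rw [← S.abelian_br i _ _ (S.eta_xi_next h) (hy i), S.comp_xi i j k h]

theorem lie_xi_phi_prev (h : evenPerm i j k) {y : L} (hy : S.inH y) :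
    ⁅S.ξ j, S.φ i y⁆ = -⁅S.ξ k, y⁆ := by
  rw [← S.abelian_br i _ _ (S.eta_xi_prev h) (hy i), S.phi_xi_prev h, neg_lie, neg_neg]

theorem phi_lie_xi_next (h : evenPerm i j k) {y : L} (hy : S.inH y) :
    S.φ i ⁅S.ξ j, y⁆ = ⁅S.ξ k, y⁆ := by
  have e := S.lie_xi_phi_prev h.rotate.rotate hy
  rw [← neg_eq_iff_eq_neg] at e
  rw [← e, map_neg, ← S.abelian_ad, S.phi_phi_prev_of_inH h.rotate.rotate hy, lie_neg, neg_neg,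
    S.lie_xi_phi_next h.rotate hy]

theorem phi_lie_xi_prev (h : evenPerm i j k) {y : L} (hy : S.inH y) :
    S.φ j ⁅S.ξ i, y⁆ = -⁅S.ξ k, y⁆ := by
  rw [← S.lie_xi_phi_next h.rotate.rotate hy, ← S.abelian_ad,
    S.phi_phi_next_of_inH h.rotate hy, S.lie_xi_phi_prev h hy]

theorem lie_xi_phi_self (h : evenPerm i j k) {y : L} (hy : S.inH y) :
    ⁅S.ξ i, S.φ i y⁆ = ⁅S.ξ k, S.φ k y⁆ := by
  rw [← S.phi_phi_next_of_inH h.rotate hy, S.lie_xi_phi_next h.rotate (S.inH_phi hy k)]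

theorem lie_phi_phi (h : evenPerm i j k) {x y : L} (hx : S.inH x) (hy : S.inH y) :
    ⁅S.φ i x, S.φ j y⁆ = -⁅S.φ j x, S.φ i y⁆ := by
  rw [← S.abelian_br k _ _ (S.inH_phi hx i k) (S.inH_phi hy j k),
    S.phi_phi_next_of_inH h.rotate.rotate hx, S.phi_phi_prev_of_inH h.rotate hy, lie_neg]

/-! ### Brackets of vertical vectors -/

theorem phi_lie_xi_xi_next (h : evenPerm i j k) :
    S.φ i ⁅S.ξ i, S.ξ j⁆ = ⁅S.ξ i, S.ξ k⁆ := by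
  rw [← S.abelian_ad, S.comp_xi i j k h]

theorem phi_lie_xi_xi_prev (h : evenPerm i j k) :
    S.φ i ⁅S.ξ i, S.ξ k⁆ = -⁅S.ξ i, S.ξ j⁆ := by
  rw [← S.abelian_ad, S.phi_xi_prev h, lie_neg]

theorem eta_lie_xi_xi_next (h : evenPerm i j k) : S.η i ⁅S.ξ i, S.ξ j⁆ = 0 := by
  rw [← neg_eq_zero, ← map_neg, ← S.phi_lie_xi_xi_prev h, S.eta_phi_self]

theorem phi_lie_xi_xi_add (h : evenPerm i j k) :
    S.φ j ⁅S.ξ i, S.ξ k⁆ + S.φ i ⁅S.ξ j, S.ξ k⁆ = 0 := by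
  have e := S.phi_lie_xi_xi_next h.rotate.rotate
  rw [← lie_skew (S.ξ i) (S.ξ k), ← lie_skew (S.ξ j) (S.ξ k), ← e, map_neg, map_neg,
    S.comp_phi' k i j h.rotate.rotate, S.eta_lie_xi_xi_next h.rotate.rotate]
  simp

/-- The polarized form of `S.abelian_ad`. -/
theorem lie_xi_phi_add (h : evenPerm i j k) (x : L) :
    ⁅S.ξ i, S.φ j x⁆ + ⁅S.ξ j, S.φ i x⁆ = S.φ j ⁅S.ξ i, x⁆ + S.φ i ⁅S.ξ j, x⁆ := by
  obtain ⟨y, hy, e⟩ := S.exists_inH_add h x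
  have e3 := S.phi_lie_xi_xi_add h
  rw [e]
  have e1 : S.φ j ⁅S.ξ i, S.ξ j⁆ = ⁅S.ξ j, S.ξ k⁆ := by
    rw [← lie_skew, map_neg, S.phi_lie_xi_xi_prev h.rotate, neg_neg]
  have e2 : S.φ i ⁅S.ξ j, S.ξ i⁆ = -⁅S.ξ i, S.ξ k⁆ := by
    rw [← lie_skew, map_neg, S.phi_lie_xi_xi_next h]
  simp only [map_add, map_smul, lie_add, lie_smul, lie_self, map_zero, smul_zero, lie_neg,
    S.phi_xi_self, S.comp_xi i j k h, S.comp_xi j k i h.rotate, S.phi_xi_prev h,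
    S.phi_xi_prev h.rotate, S.lie_xi_phi_prev h hy,
    S.lie_xi_phi_next h.rotate hy, S.phi_lie_xi_next h hy, S.phi_lie_xi_prev h hy, e1, e2, lie_zero]
  linear_combination (norm := module) (-S.η k x) • e3

end Basic

section Sphere

variable {L : Type*} [LieRing L] [LieAlgebra ℝ L] (S : AbelianAC3 L) {a₁ a₂ a₃ : ℝ}

/-- The endomorphism `φ_a` acts on vertical vectors as the cross product with `a`. -/
theorem sphere_phi_vertical (a₁ a₂ a₃ b₁ b₂ b₃ : ℝ) :
    (a₁ • S.φ 0 + a₂ • S.φ 1 + a₃ • S.φ 2) (b₁ • S.ξ 0 + b₂ • S.ξ 1 + b₃ • S.ξ 2) =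
      (a₂ * b₃ - a₃ * b₂) • S.ξ 0 + (a₃ * b₁ - a₁ * b₃) • S.ξ 1 +
        (a₁ * b₂ - a₂ * b₁) • S.ξ 2 := by
  have h := evenPerm_zero_one_two
  simp only [LinearMap.add_apply, LinearMap.smul_apply, map_add, map_smul, S.phi_xi_self,
    S.comp_xi _ _ _ h, S.comp_xi _ _ _ h.rotate, S.comp_xi _ _ _ h.rotate.rotate,
    S.phi_xi_prev h, S.phi_xi_prev h.rotate, S.phi_xi_prev h.rotate.rotate]
  module

theorem sphere_phi_phi (ha : a₁ ^ 2 + a₂ ^ 2 + a₃ ^ 2 = 1) (x : L) :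
    (a₁ • S.φ 0 + a₂ • S.φ 1 + a₃ • S.φ 2) ((a₁ • S.φ 0 + a₂ • S.φ 1 + a₃ • S.φ 2) x) =
      -x + ((a₁ • S.η 0 + a₂ • S.η 1 + a₃ • S.η 2) x) •
        (a₁ • S.ξ 0 + a₂ • S.ξ 1 + a₃ • S.ξ 2) := by
  have anti {i j k : Fin 3} (h : evenPerm i j k) : S.φ i (S.φ j x) =
      -S.φ j (S.φ i x) + S.η i x • S.ξ j + S.η j x • S.ξ i := by
    rw [← S.comp_phi' i j k h, S.comp_phi i j k h, sub_add_cancel]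
  have h := evenPerm_zero_one_two
  simp only [LinearMap.add_apply, LinearMap.smul_apply, map_add, map_smul, S.acs, anti h,
    anti h.rotate, anti h.rotate.rotate, smul_eq_mul]
  linear_combination (norm := module) (-ha) • x

theorem sphere_eta_xi (ha : a₁ ^ 2 + a₂ ^ 2 + a₃ ^ 2 = 1) :
    (a₁ • S.η 0 + a₂ • S.η 1 + a₃ • S.η 2) (a₁ • S.ξ 0 + a₂ • S.ξ 1 + a₃ • S.ξ 2) = 1 := by
  have h := evenPerm_zero_one_two
  simp only [LinearMap.add_apply, LinearMap.smul_apply, map_add, map_smul, S.unit,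
    S.eta_xi_next h, S.eta_xi_prev h, S.eta_xi_next h.rotate, S.eta_xi_prev h.rotate,
    S.eta_xi_next h.rotate.rotate, S.eta_xi_prev h.rotate.rotate, smul_eq_mul]
  linear_combination ha

theorem sphere_lie_xi_phi (a₁ a₂ a₃ : ℝ) (x : L) :
    ⁅a₁ • S.ξ 0 + a₂ • S.ξ 1 + a₃ • S.ξ 2, (a₁ • S.φ 0 + a₂ • S.φ 1 + a₃ • S.φ 2) x⁆ =
      (a₁ • S.φ 0 + a₂ • S.φ 1 + a₃ • S.φ 2) ⁅a₁ • S.ξ 0 + a₂ • S.ξ 1 + a₃ • S.ξ 2, x⁆ := by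
  have h := evenPerm_zero_one_two
  simp only [LinearMap.add_apply, LinearMap.smul_apply, map_add, map_smul, add_lie, lie_add,
    smul_lie, lie_smul, S.abelian_ad]
  linear_combination (norm := module) (a₁ * a₂) • S.lie_xi_phi_add h x +
    (a₂ * a₃) • S.lie_xi_phi_add h.rotate x + (a₃ * a₁) • S.lie_xi_phi_add h.rotate.rotate x

theorem sphere_lie_phi_phi_of_inH (ha : a₁ ^ 2 + a₂ ^ 2 + a₃ ^ 2 = 1) {x y : L}
    (hx : S.inH x) (hy : S.inH y) :
    ⁅(a₁ • S.φ 0 + a₂ • S.φ 1 + a₃ • S.φ 2) x, (a₁ • S.φ 0 + a₂ • S.φ 1 + a₃ • S.φ 2) y⁆ =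
      ⁅x, y⁆ := by
  have h := evenPerm_zero_one_two
  simp only [LinearMap.add_apply, LinearMap.smul_apply, add_lie, lie_add, smul_lie, lie_smul,
    S.abelian_br _ x y (hx _) (hy _), S.lie_phi_phi h hx hy, S.lie_phi_phi h.rotate hx hy,
    S.lie_phi_phi h.rotate.rotate hx hy]
  linear_combination (norm := module) ha • ⁅x, y⁆

theorem sphere_lie_phi_phi_vertical_of_inH (ha : a₁ ^ 2 + a₂ ^ 2 + a₃ ^ 2 = 1) {b₁ b₂ b₃ : ℝ}
    (hb : a₁ * b₁ + a₂ * b₂ + a₃ * b₃ = 0) {y : L} (hy : S.inH y) :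
    ⁅(a₁ • S.φ 0 + a₂ • S.φ 1 + a₃ • S.φ 2) (b₁ • S.ξ 0 + b₂ • S.ξ 1 + b₃ • S.ξ 2),
        (a₁ • S.φ 0 + a₂ • S.φ 1 + a₃ • S.φ 2) y⁆ =
      ⁅b₁ • S.ξ 0 + b₂ • S.ξ 1 + b₃ • S.ξ 2, y⁆ := by
  have h := evenPerm_zero_one_two
  rw [sphere_phi_vertical]
  simp only [LinearMap.add_apply, LinearMap.smul_apply, add_lie, lie_add, smul_lie, lie_smul,
    S.lie_xi_phi_next h hy, S.lie_xi_phi_next h.rotate hy, S.lie_xi_phi_next h.rotate.rotate hy,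
    S.lie_xi_phi_prev h hy, S.lie_xi_phi_prev h.rotate hy, S.lie_xi_phi_prev h.rotate.rotate hy,
    S.lie_xi_phi_self h hy, S.lie_xi_phi_self h.rotate.rotate hy]
  linear_combination (norm := module)
    ha • (b₁ • ⁅S.ξ 0, y⁆ + b₂ • ⁅S.ξ 1, y⁆ + b₃ • ⁅S.ξ 2, y⁆) -
      hb • (a₁ • ⁅S.ξ 0, y⁆ + a₂ • ⁅S.ξ 1, y⁆ + a₃ • ⁅S.ξ 2, y⁆)

theorem lie_vertical_vertical (b₁ b₂ b₃ c₁ c₂ c₃ : ℝ) :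
    ⁅b₁ • S.ξ 0 + b₂ • S.ξ 1 + b₃ • S.ξ 2, c₁ • S.ξ 0 + c₂ • S.ξ 1 + c₃ • S.ξ 2⁆ =
      (b₂ * c₃ - b₃ * c₂) • ⁅S.ξ 1, S.ξ 2⁆ + (b₃ * c₁ - b₁ * c₃) • ⁅S.ξ 2, S.ξ 0⁆ +
        (b₁ * c₂ - b₂ * c₁) • ⁅S.ξ 0, S.ξ 1⁆ := by
  simp only [add_lie, lie_add, smul_lie, lie_smul, lie_self]
  rw [← lie_skew (S.ξ 1) (S.ξ 0), ← lie_skew (S.ξ 2) (S.ξ 1), ← lie_skew (S.ξ 0) (S.ξ 2)]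
  module

theorem sphere_lie_phi_phi_vertical (ha : a₁ ^ 2 + a₂ ^ 2 + a₃ ^ 2 = 1) {b₁ b₂ b₃ c₁ c₂ c₃ : ℝ}
    (hb : a₁ * b₁ + a₂ * b₂ + a₃ * b₃ = 0) (hc : a₁ * c₁ + a₂ * c₂ + a₃ * c₃ = 0) :
    ⁅(a₁ • S.φ 0 + a₂ • S.φ 1 + a₃ • S.φ 2) (b₁ • S.ξ 0 + b₂ • S.ξ 1 + b₃ • S.ξ 2),
        (a₁ • S.φ 0 + a₂ • S.φ 1 + a₃ • S.φ 2) (c₁ • S.ξ 0 + c₂ • S.ξ 1 + c₃ • S.ξ 2)⁆ =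
      ⁅b₁ • S.ξ 0 + b₂ • S.ξ 1 + b₃ • S.ξ 2, c₁ • S.ξ 0 + c₂ • S.ξ 1 + c₃ • S.ξ 2⁆ := by
  rw [sphere_phi_vertical, sphere_phi_vertical, lie_vertical_vertical, lie_vertical_vertical]
  have h1 : (a₃ * b₁ - a₁ * b₃) * (a₁ * c₂ - a₂ * c₁) - (a₁ * b₂ - a₂ * b₁) * (a₃ * c₁ - a₁ * c₃) =
      b₂ * c₃ - b₃ * c₂ := by
    linear_combination (b₂ * c₃ - b₃ * c₂) * ha - (a₂ * c₃ - a₃ * c₂) * hb +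
      (a₂ * b₃ - a₃ * b₂) * hc
  have h2 : (a₁ * b₂ - a₂ * b₁) * (a₂ * c₃ - a₃ * c₂) - (a₂ * b₃ - a₃ * b₂) * (a₁ * c₂ - a₂ * c₁) =
      b₃ * c₁ - b₁ * c₃ := by
    linear_combination (b₃ * c₁ - b₁ * c₃) * ha - (a₃ * c₁ - a₁ * c₃) * hb +
      (a₃ * b₁ - a₁ * b₃) * hc
  have h3 : (a₂ * b₃ - a₃ * b₂) * (a₃ * c₁ - a₁ * c₃) - (a₃ * b₁ - a₁ * b₃) * (a₂ * c₃ - a₃ * c₂) =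
      b₁ * c₂ - b₂ * c₁ := by
    linear_combination (b₁ * c₂ - b₂ * c₁) * ha - (a₁ * c₂ - a₂ * c₁) * hb +
      (a₁ * b₂ - a₂ * b₁) * hc
  rw [h1, h2, h3]

theorem sphere_lie_phi_phi (ha : a₁ ^ 2 + a₂ ^ 2 + a₃ ^ 2 = 1) {X Y : L}
    (hX : (a₁ • S.η 0 + a₂ • S.η 1 + a₃ • S.η 2) X = 0)
    (hY : (a₁ • S.η 0 + a₂ • S.η 1 + a₃ • S.η 2) Y = 0) :
    ⁅(a₁ • S.φ 0 + a₂ • S.φ 1 + a₃ • S.φ 2) X, (a₁ • S.φ 0 + a₂ • S.φ 1 + a₃ • S.φ 2) Y⁆ =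
      ⁅X, Y⁆ := by
  obtain ⟨x, hx, eX⟩ := S.exists_inH_add evenPerm_zero_one_two X
  obtain ⟨y, hy, eY⟩ := S.exists_inH_add evenPerm_zero_one_two Y
  simp only [LinearMap.add_apply, LinearMap.smul_apply, smul_eq_mul] at hX hY
  have hXy := S.sphere_lie_phi_phi_vertical_of_inH ha hX hy
  have hYx := S.sphere_lie_phi_phi_vertical_of_inH ha hY hx
  have hXY := S.sphere_lie_phi_phi_vertical ha hX hY
  have hxy := S.sphere_lie_phi_phi_of_inH ha hx hy
  rw [add_assoc, add_assoc, ← add_assoc (S.η 0 _ • _)] at eX eY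
  generalize a₁ • S.φ 0 + a₂ • S.φ 1 + a₃ • S.φ 2 = f at *
  generalize S.η 0 X • S.ξ 0 + S.η 1 X • S.ξ 1 + S.η 2 X • S.ξ 2 = v at *
  generalize S.η 0 Y • S.ξ 0 + S.η 1 Y • S.ξ 1 + S.η 2 Y • S.ξ 2 = w at *
  have hxw : ⁅f x, f w⁆ = ⁅x, w⁆ := by rw [← lie_skew, hYx, lie_skew]
  rw [eX, eY]
  simp only [map_add, add_lie, lie_add, hxy, hxw, hXy, hXY]

end Sphere

end AbelianAC3

/-- every structure in the sphere associated to an abelian almost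
3-contact structure is an abelian almost contact structure. -/
theorem AbelianAC3.sphere_abelian
    {L : Type*} [LieRing L] [LieAlgebra ℝ L] [FiniteDimensional ℝ L]
    (S : AbelianAC3 L) (a₁ a₂ a₃ : ℝ) (ha : a₁ ^ 2 + a₂ ^ 2 + a₃ ^ 2 = 1) :
    -- `(φ_a, ξ_a, η_a)` is an almost contact structure
    ((∀ x : L,
        (a₁ • S.φ 0 + a₂ • S.φ 1 + a₃ • S.φ 2)
            ((a₁ • S.φ 0 + a₂ • S.φ 1 + a₃ • S.φ 2) x) =
          -x + ((a₁ • S.η 0 + a₂ • S.η 1 + a₃ • S.η 2) x) •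
            (a₁ • S.ξ 0 + a₂ • S.ξ 1 + a₃ • S.ξ 2)) ∧
      (a₁ • S.η 0 + a₂ • S.η 1 + a₃ • S.η 2) (a₁ • S.ξ 0 + a₂ • S.ξ 1 + a₃ • S.ξ 2) = 1)
    ∧
    -- and it is abelian
    ((∀ x : L,
        ⁅a₁ • S.ξ 0 + a₂ • S.ξ 1 + a₃ • S.ξ 2,
          (a₁ • S.φ 0 + a₂ • S.φ 1 + a₃ • S.φ 2) x⁆ =
        (a₁ • S.φ 0 + a₂ • S.φ 1 + a₃ • S.φ 2)
          ⁅a₁ • S.ξ 0 + a₂ • S.ξ 1 + a₃ • S.ξ 2, x⁆) ∧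
      (∀ X Y : L,
        (a₁ • S.η 0 + a₂ • S.η 1 + a₃ • S.η 2) X = 0 →
        (a₁ • S.η 0 + a₂ • S.η 1 + a₃ • S.η 2) Y = 0 →
        ⁅(a₁ • S.φ 0 + a₂ • S.φ 1 + a₃ • S.φ 2) X,
          (a₁ • S.φ 0 + a₂ • S.φ 1 + a₃ • S.φ 2) Y⁆ = ⁅X, Y⁆)) := by
  exact ⟨⟨S.sphere_phi_phi ha, S.sphere_eta_xi ha⟩, S.sphere_lie_xi_phi a₁ a₂ a₃,
    fun _ _ hX hY ↦ S.sphere_lie_phi_phi ha hX hY⟩
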